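/- arXiv:2005.07179 — 6 statements merged into one kernel-verified Lean document; each statement's English description precedes it below -/
import Mathlib

section
/- Let n ≥ 1 be an integer, let x₀ ∈ ℝⁿ and δ > 0, and let F be a real-valued C¹ function on the open ball B(x₀, δ) ⊆ ℝⁿ. Let T ∈ ℝⁿ be a nonzero vector, and assume that for every x ∈ B(x₀, δ) one has |∇F(x) · T| > |T| · |F(x₀)| / δ. Then there exists a point x ∈ B(x₀, δ) with F(x) = 0. -/
open Metric RealInnerProductSpace

/-- One-dimensional version with a positive derivative and a positive value at `0`. -/
lemma eft_aux_pos (g g' : ℝ → ℝ) (r : ℝ) (hr : 0 < r) (h0 : 0 < g 0)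
    (hg : ∀ t ∈ Set.Ioo (-r) r, HasDerivAt g (g' t) t)
    (hb : ∀ t ∈ Set.Ioo (-r) r, g 0 / r < g' t) :
    ∃ t ∈ Set.Ioo (-r) r, g t = 0 := by
  set c := g 0 / r with hc
  have hcpos : 0 < c := div_pos h0 hr
  have hcr : c * r = g 0 := by rw [hc]; field_simp
  have hmono : StrictMonoOn (fun t => g t - c * t) (Set.Ioo (-r) r) := by
    have hd : ∀ t ∈ Set.Ioo (-r) r, HasDerivAt (fun t => g t - c * t) (g' t - c) t := by
      intro t ht
      have h := (hg t ht).sub ((hasDerivAt_id t).const_mul c)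
      rw [mul_one] at h
      exact h
    apply strictMonoOn_of_deriv_pos (convex_Ioo _ _)
    · intro t ht
      exact (hd t ht).continuousAt.continuousWithinAt
    · intro t ht
      rw [interior_Ioo] at ht
      rw [(hd t ht).deriv]
      linarith [hb t ht]
  have m0 : (0 : ℝ) ∈ Set.Ioo (-r) r := ⟨by linarith, hr⟩
  have m1 : -(r / 2) ∈ Set.Ioo (-r) r := ⟨by linarith, by linarith⟩
  have h1 := hmono m1 m0 (by linarith)
  simp only at h1
  by_contra! hne
  have hpos : ∀ t ∈ Set.Ioo (-r) r, 0 < g t := by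
    intro t ht
    by_contra! hle
    obtain ⟨s, hs, hs0⟩ := (isPreconnected_Ioo (a := -r) (b := r)).intermediate_value ht m0
      (f := g) (fun u hu => (hg u hu).continuousAt.continuousWithinAt) ⟨hle, h0.le⟩
    exact hne s hs hs0
  set e := g 0 - (g (-(r / 2)) - c * (-(r / 2))) with he
  have hepos : 0 < e := by linarith
  have helt : e < c * r / 2 := by
    have := hpos _ m1
    linarith
  have hec : e / c < r / 2 := by
    rw [div_lt_iff₀ hcpos]; linarith
  have hec0 : 0 < e / c := div_pos hepos hcpos
  have m2 : -r + e / c ∈ Set.Ioo (-r) r := ⟨by linarith, by linarith⟩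
  have h2 := hmono m2 m1 (by linarith)
  have h3 := hpos _ m2
  simp only at h2
  have h4 : c * (-r + e / c) = -(c * r) + e := by field_simp
  linarith

/-- One-dimensional version. -/
lemma eft_aux (g g' : ℝ → ℝ) (r : ℝ) (hr : 0 < r)
    (hg : ∀ t ∈ Set.Ioo (-r) r, HasDerivAt g (g' t) t)
    (hb : ∀ t ∈ Set.Ioo (-r) r, |g 0| / r < |g' t|) :
    ∃ t ∈ Set.Ioo (-r) r, g t = 0 := by
  have hneg : ∀ t ∈ Set.Ioo (-r) r, -t ∈ Set.Ioo (-r) r := fun t ht =>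
    ⟨by linarith [ht.2], by linarith [ht.1]⟩
  have key : ∀ t ∈ Set.Ioo (-r) r, HasDerivAt (fun s => g (-s)) (-g' (-t)) t := by
    intro t ht
    have h := (hg _ (hneg t ht)).comp t (hasDerivAt_neg t)
    rw [mul_neg_one] at h
    exact h
  have hab : 0 ≤ |g 0| / r := by positivity
  have hs := hasDerivWithinAt_forall_lt_or_forall_gt_of_forall_ne (convex_Ioo (-r) r)
    (fun t ht => (hg t ht).hasDerivWithinAt) (m := 0) (fun t ht h => by
      have := hb t ht
      rw [h, abs_zero] at this
      linarith)
  rcases lt_trichotomy (g 0) 0 with h0 | h0 | h0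
  · rcases hs with hs | hs
    · obtain ⟨t, ht, h⟩ := eft_aux_pos (fun t => -g t) (fun t => -g' t) r hr (by simpa using h0)
        (fun t ht => (hg t ht).neg) (fun t ht => by
          have := hb t ht
          rwa [abs_of_neg h0, abs_of_neg (hs t ht)] at this)
      exact ⟨t, ht, by simpa using h⟩
    · obtain ⟨t, ht, h⟩ := eft_aux_pos (fun t => -g (-t)) (fun t => - -g' (-t)) r hr
        (by simpa using h0)
        (fun t ht => (key t ht).neg) (fun t ht => by
          have := hb _ (hneg t ht)
          rw [abs_of_neg h0, abs_of_pos (hs _ (hneg t ht))] at this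
          simpa using this)
      exact ⟨-t, hneg t ht, by simpa using h⟩
  · exact ⟨0, ⟨by linarith, hr⟩, h0⟩
  · rcases hs with hs | hs
    · obtain ⟨t, ht, h⟩ := eft_aux_pos (fun t => g (-t)) (fun t => -g' (-t)) r hr
        (by simpa using h0) key (fun t ht => by
          have := hb _ (hneg t ht)
          rw [abs_of_pos h0, abs_of_neg (hs _ (hneg t ht))] at this
          simpa using this)
      exact ⟨-t, hneg t ht, h⟩
    · exact eft_aux_pos g g' r hr h0 hg (fun t ht => by
          have := hb t ht
          rwa [abs_of_pos h0, abs_of_pos (hs t ht)] at this)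

/-- **Explicit function theorem**: if `F` is `C¹` on the open ball `B(x₀, δ)` in `ℝⁿ`,
`T ≠ 0`, and `|∇F(x) ⬝ T| > ‖T‖ |F x₀| / δ` throughout the ball, then `F` vanishes
somewhere in the ball. -/
theorem explicit_function_theorem
    {n : ℕ} (hn : 1 ≤ n)
    (x₀ : EuclideanSpace ℝ (Fin n)) (δ : ℝ) (hδ : 0 < δ)
    (F : EuclideanSpace ℝ (Fin n) → ℝ)
    (hF : ∀ x ∈ ball x₀ δ, DifferentiableAt ℝ F x)
    (hF' : ContinuousOn (gradient F) (ball x₀ δ))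
    (T : EuclideanSpace ℝ (Fin n)) (hT : T ≠ 0)
    (hgrad : ∀ x ∈ ball x₀ δ, |⟪gradient F x, T⟫| > ‖T‖ * |F x₀| / δ) :
    ∃ x ∈ ball x₀ δ, F x = 0 := by
  have hTn : 0 < ‖T‖ := norm_pos_iff.mpr hT
  have hmem : ∀ t ∈ Set.Ioo (-(δ / ‖T‖)) (δ / ‖T‖), x₀ + t • T ∈ ball x₀ δ := by
    intro t ht
    have h : |t| < δ / ‖T‖ := abs_lt.mpr ht
    rw [lt_div_iff₀ hTn] at h
    simpa [mem_ball, dist_eq_norm, norm_smul] using h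
  obtain ⟨t, ht, h⟩ := eft_aux (fun t => F (x₀ + t • T)) (fun t => ⟪gradient F (x₀ + t • T), T⟫)
    (δ / ‖T‖) (div_pos hδ hTn)
    (fun t ht => by
      have h1 := (hF _ (hmem t ht)).hasGradientAt.hasFDerivAt
      have h2 : HasDerivAt (fun t : ℝ => x₀ + t • T) T t := by
        simpa using ((hasDerivAt_id t).smul_const T).const_add x₀
      exact h1.comp_hasDerivAt t h2)
    (fun t ht => by
      have h1 := hgrad _ (hmem t ht)
      have h2 : |F x₀| / (δ / ‖T‖) = ‖T‖ * |F x₀| / δ := by field_simp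
      simpa [h2] using h1)
  exact ⟨_, hmem t ht, h⟩
end

section
/- Fix δ > 0 and 0 ≤ c < 1. Define F : ℝ² → ℝ by F(x) = x₁ (the first coordinate of x), let x₀ = (δ, 0) and T = (1, 0). Then for every x in the open ball B(x₀, δ) one has |∇F(x) · T| > c · |T| · |F(x₀)| / δ, and yet F(x) ≠ 0 for every x ∈ B(x₀, δ). Consequently, in the explicit function theorem the hypothesis |∇F(x)·T| > |T|·|F(x₀)|/δ cannot be relaxed to |∇F(x)·T| > c·|T|·|F(x₀)|/δ for any constant c < 1. -/
open Metric RealInnerProductSpace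

/-- Sharpness of the explicit function theorem: for `F(x) = x₁`, `x₀ = (δ, 0)`,
`T = (1, 0)` and any `0 ≤ c < 1`, the relaxed hypothesis
`|∇F(x) ⬝ T| > c ‖T‖ |F x₀| / δ` holds on all of `B(x₀, δ)`, and yet `F` has no zero
in `B(x₀, δ)`. -/
theorem explicit_function_theorem_sharp
    (δ : ℝ) (hδ : 0 < δ) (c : ℝ) (hc0 : 0 ≤ c) (hc1 : c < 1)
    (F : EuclideanSpace ℝ (Fin 2) → ℝ) (hFdef : ∀ x, F x = x 0)
    (x₀ T : EuclideanSpace ℝ (Fin 2))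
    (hx₀ : x₀ = (WithLp.equiv 2 (Fin 2 → ℝ)).symm ![δ, 0])
    (hT : T = (WithLp.equiv 2 (Fin 2 → ℝ)).symm ![1, 0]) :
    (∀ x ∈ ball x₀ δ, |⟪gradient F x, T⟫| > c * ‖T‖ * |F x₀| / δ) ∧
      ∀ x ∈ ball x₀ δ, F x ≠ 0 := by
  have hF : F = fun x => (EuclideanSpace.proj (0 : Fin 2) : EuclideanSpace ℝ (Fin 2) →L[ℝ] ℝ) x := by
    funext x
    simp [hFdef]
  have hF0 : F x₀ = δ := by simp [hFdef, hx₀]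
  have hTn : ‖T‖ = 1 := by
    rw [EuclideanSpace.norm_eq, hT]
    simp
  have hT0 : T 0 = 1 := by simp [hT]
  constructor
  · intro x _
    have hg : ⟪gradient F x, T⟫ = 1 := by
      have h1 : ⟪gradient F x, T⟫ = fderiv ℝ F x T := by
        unfold gradient
        exact InnerProductSpace.toDual_symm_apply
      rw [h1, hF, ContinuousLinearMap.fderiv]
      simpa using hT0
    rw [hg, hTn, hF0, abs_of_pos hδ, mul_one, mul_div_assoc, div_self hδ.ne']
    simpa using hc1
  · intro x hx h0
    rw [mem_ball, dist_eq_norm] at hx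
    have h2 := PiLp.norm_apply_le (x - x₀) 0
    have h3 : (x - x₀) 0 = -δ := by
      have e1 : x 0 = 0 := by rw [← hFdef, h0]
      have e2 : x₀ 0 = δ := by rw [← hFdef, hF0]
      simp [e1, e2]
    rw [h3, norm_neg, Real.norm_of_nonneg hδ.le] at h2
    linarith
end

section
/- Let n ≥ 1 be an integer, let x₀ ∈ ℝⁿ and δ > 0, and let G be a real-valued C¹ function on the open ball B(x₀, δ) with G(x₀) = 0 and ∇G(x₀) ≠ 0. Let F be another C¹ function on B(x₀, δ), and suppose there is ε ≥ 0 such that for every x ∈ B(x₀, δ) one has max( |F(x) − G(x)|, |∇F(x) − ∇G(x)| ) ≤ ε and ε < (δ/(1+δ)) · |∇G(x) · ∇G(x₀)| / |∇G(x₀)|. Then F has a zero in B(x₀, δ). -/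
open Metric RealInnerProductSpace

theorem exists_pos_aux (f f' : ℝ → ℝ) (δ ε : ℝ) (hδ : 0 < δ) (hε : 0 ≤ ε)
    (hf : ∀ t ∈ Set.Ioo (-δ) δ, HasDerivAt f (f' t) t)
    (hf' : ∀ t ∈ Set.Ioo (-δ) δ, ε / δ < f' t) (h0 : -ε ≤ f 0) :
    ∃ t ∈ Set.Ioo (-δ) δ, 0 < f t := by
  have hd : ∀ t ∈ Set.Ioo (-δ) δ, HasDerivAt (fun t => f t - ε / δ * t) (f' t - ε / δ) t := by
    intro t ht
    have h2 := (hasDerivAt_id t).const_mul (ε / δ)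
    have h3 := (hf t ht).sub h2
    rw [mul_one] at h3
    exact h3
  have hm : StrictMonoOn (fun t => f t - ε / δ * t) (Set.Ioo (-δ) δ) := by
    apply strictMonoOn_of_deriv_pos (convex_Ioo _ _)
    · exact fun t ht => (hd t ht).continuousAt.continuousWithinAt
    · intro t ht
      rw [interior_Ioo] at ht
      rw [(hd t ht).deriv]
      linarith [hf' t ht]
  have h1 := hm (a := 0) ⟨by linarith, hδ⟩ (b := δ / 2) ⟨by linarith, by linarith⟩ (by linarith)
  simp only [mul_zero, sub_zero] at h1
  set c := f (δ / 2) - ε / δ * (δ / 2) - f 0 with hc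
  have hcpos : 0 < c := by linarith
  set s := min (1 / 2) (c / (ε + 1)) with hs
  have hspos : 0 < s := lt_min (by norm_num) (by positivity)
  have hs2 : s ≤ 1 / 2 := min_le_left _ _
  have hsc : s * (ε + 1) ≤ c := (le_div_iff₀ (by linarith)).1 (min_le_right _ _)
  have ht : δ * (1 - s) ∈ Set.Ioo (-δ) δ := ⟨by nlinarith, by nlinarith⟩
  refine ⟨δ * (1 - s), ht, ?_⟩
  have h3 := hm.monotoneOn (a := δ / 2) ⟨by linarith, by linarith⟩ ht (by nlinarith)
  have h4 : ε / δ * (δ * (1 - s)) = ε * (1 - s) := by field_simp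
  rw [h4] at h3
  nlinarith

theorem exists_zero_aux (f f' : ℝ → ℝ) (δ ε : ℝ) (hδ : 0 < δ) (hε : 0 ≤ ε)
    (hf : ∀ t ∈ Set.Ioo (-δ) δ, HasDerivAt f (f' t) t)
    (hf' : ∀ t ∈ Set.Ioo (-δ) δ, ε / δ < f' t) (h0 : |f 0| ≤ ε) :
    ∃ t ∈ Set.Ioo (-δ) δ, f t = 0 := by
  obtain ⟨a, ha, hfa⟩ := exists_pos_aux f f' δ ε hδ hε hf hf' (abs_le.1 h0).1
  have hneg : ∀ t ∈ Set.Ioo (-δ) δ, -t ∈ Set.Ioo (-δ) δ :=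
    fun t ht => ⟨by linarith [ht.2], by linarith [ht.1]⟩
  obtain ⟨b, hb, hfb⟩ := exists_pos_aux (fun t => -f (-t)) (fun t => f' (-t)) δ ε hδ hε
    (fun t ht => by
      have h := ((hf (-t) (hneg t ht)).comp t (hasDerivAt_neg t)).neg
      have e : -(f' (-t) * -1) = f' (-t) := by ring
      rw [e] at h
      exact h)
    (fun t ht => hf' _ (hneg t ht)) (by simpa using (abs_le.1 h0).2)
  have hcont : ContinuousOn f (Set.Ioo (-δ) δ) :=
    fun t ht => (hf t ht).continuousAt.continuousWithinAt
  exact isPreconnected_Ioo.intermediate_value (hneg b hb) ha hcont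
    ⟨by linarith, hfa.le⟩

/-- Quantitative implicit function theorem via approximation: if `G` is `C¹` on
`B(x₀, δ)` with `G x₀ = 0` and `∇G x₀ ≠ 0`, and `F` is `C¹` on `B(x₀, δ)` with
`max (|F - G|, ‖∇F - ∇G‖) ≤ ε` where
`ε < (δ/(1+δ)) ⬝ |∇G(x) ⬝ ∇G(x₀)| / ‖∇G(x₀)‖` throughout the ball,
then `F` has a zero in `B(x₀, δ)`. -/
theorem zero_of_C1_approximation
    {n : ℕ} (hn : 1 ≤ n)
    (x₀ : EuclideanSpace ℝ (Fin n)) (δ : ℝ) (hδ : 0 < δ)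
    (G : EuclideanSpace ℝ (Fin n) → ℝ)
    (hG : ∀ x ∈ ball x₀ δ, DifferentiableAt ℝ G x)
    (hG' : ContinuousOn (gradient G) (ball x₀ δ))
    (hG0 : G x₀ = 0) (hGgrad : gradient G x₀ ≠ 0)
    (F : EuclideanSpace ℝ (Fin n) → ℝ)
    (hF : ∀ x ∈ ball x₀ δ, DifferentiableAt ℝ F x)
    (hF' : ContinuousOn (gradient F) (ball x₀ δ))
    (ε : ℝ) (hε : 0 ≤ ε)
    (happrox : ∀ x ∈ ball x₀ δ,
      max |F x - G x| ‖gradient F x - gradient G x‖ ≤ ε)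
    (hsmall : ∀ x ∈ ball x₀ δ,
      ε < (δ / (1 + δ)) * |⟪gradient G x, gradient G x₀⟫| / ‖gradient G x₀‖) :
    ∃ x ∈ ball x₀ δ, F x = 0 := by
  have hN : 0 < ‖gradient G x₀‖ := norm_pos_iff.2 hGgrad
  have hx₀ : x₀ ∈ ball x₀ δ := mem_ball_self hδ
  have hpos : ∀ x ∈ ball x₀ δ, 0 < ⟪gradient G x, gradient G x₀⟫ := by
    intro x hx
    by_contra hcon
    have hc : ContinuousOn (fun x => ⟪gradient G x, gradient G x₀⟫) (ball x₀ δ) :=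
      hG'.inner continuousOn_const
    obtain ⟨y, hy, hy0⟩ := (convex_ball x₀ δ).isPreconnected.intermediate_value hx hx₀ hc
      (show (0 : ℝ) ∈ Set.Icc _ _ from ⟨not_lt.1 hcon, real_inner_self_nonneg⟩)
    have h := hsmall y hy
    simp only at hy0
    rw [hy0] at h
    simp at h
    linarith
  set u := (‖gradient G x₀‖)⁻¹ • gradient G x₀ with hu
  have hu1 : ‖u‖ = 1 := by
    rw [hu, norm_smul, norm_inv, norm_norm, inv_mul_cancel₀ hN.ne']
  have hmem : ∀ t ∈ Set.Ioo (-δ) δ, x₀ + t • u ∈ ball x₀ δ := by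
    intro t ht
    rw [mem_ball, dist_eq_norm, add_sub_cancel_left, norm_smul, hu1, mul_one, Real.norm_eq_abs]
    exact abs_lt.2 ht
  have key : ∃ t ∈ Set.Ioo (-δ) δ, (fun t : ℝ => F (x₀ + t • u)) t = 0 := by
    refine exists_zero_aux (fun t => F (x₀ + t • u))
      (fun t => ⟪gradient F (x₀ + t • u), u⟫) δ ε hδ hε ?_ ?_ ?_
    · intro t ht
      have h1 := (hF _ (hmem t ht)).hasGradientAt.hasFDerivAt
      have h2 : HasDerivAt (fun t : ℝ => x₀ + t • u) u t := by
        simpa using ((hasDerivAt_id t).smul_const u).const_add x₀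
      exact h1.comp_hasDerivAt t h2
    · intro t ht
      have hx := hmem t ht
      set x := x₀ + t • u
      have h1 := hsmall x hx
      rw [abs_of_pos (hpos x hx)] at h1
      have h2 : ⟪gradient G x, u⟫ = ⟪gradient G x, gradient G x₀⟫ / ‖gradient G x₀‖ := by
        rw [hu, real_inner_smul_right]; ring
      rw [mul_div_assoc, ← h2, div_mul_eq_mul_div, lt_div_iff₀ (by linarith)] at h1
      have h3 : |⟪gradient F x - gradient G x, u⟫| ≤ ε := by
        refine (abs_real_inner_le_norm _ _).trans ?_
        rw [hu1, mul_one]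
        exact (le_max_right _ _).trans (happrox x hx)
      rw [inner_sub_left] at h3
      have h4 := (abs_le.1 h3).1
      change ε / δ < ⟪gradient F x, u⟫
      rw [div_lt_iff₀ hδ]
      nlinarith
    · have := (le_max_left _ _).trans (happrox x₀ hx₀)
      simpa [hG0] using this
  obtain ⟨t, ht, h⟩ := key
  exact ⟨_, hmem t ht, h⟩
end

section
/- Let a > δ > 0 and let x₀ ∈ ℝ² with |x₀| = a. Then every x ∈ ℝ² with |x − x₀| ≤ δ satisfies x ≠ 0 and (x · x₀)/(|x| · |x₀|) ≥ √(1 − δ²/a²). In other words, the cosine of the angle between x and x₀ is at least √(1 − δ²/a²) for all points x in the closed ball of radius δ around x₀. -/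
open Metric RealInnerProductSpace

/-- If `|x₀| = a > δ > 0`, then every `x` in the closed ball of radius `δ` around `x₀`
is nonzero and the cosine of the angle between `x` and `x₀` is at least
`√(1 - δ²/a²)`. -/
theorem cos_angle_ge_of_mem_closedBall
    (a δ : ℝ) (hδ : 0 < δ) (hδa : δ < a)
    (x₀ : EuclideanSpace ℝ (Fin 2)) (hx₀ : ‖x₀‖ = a)
    (x : EuclideanSpace ℝ (Fin 2)) (hx : ‖x - x₀‖ ≤ δ) :
    x ≠ 0 ∧ Real.sqrt (1 - δ ^ 2 / a ^ 2) ≤ ⟪x, x₀⟫ / (‖x‖ * ‖x₀‖) := by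
  have ha : 0 < a := hδ.trans hδa
  have hne : x ≠ 0 := by
    rintro rfl
    rw [zero_sub, norm_neg, hx₀] at hx
    linarith
  refine ⟨hne, ?_⟩
  have hr : 0 < ‖x‖ := norm_pos_iff.mpr hne
  have h1 : ‖x - x₀‖ ^ 2 = ‖x‖ ^ 2 - 2 * ⟪x, x₀⟫ + ‖x₀‖ ^ 2 := norm_sub_sq_real x x₀
  have h2 : ‖x - x₀‖ ^ 2 ≤ δ ^ 2 := pow_le_pow_left₀ (norm_nonneg _) hx 2
  rw [hx₀] at h1 ⊢
  have h0 : 0 ≤ 1 - δ ^ 2 / a ^ 2 := by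
    rw [sub_nonneg, div_le_one (by positivity)]
    exact pow_le_pow_left₀ hδ.le hδa.le 2
  have ht := Real.sq_sqrt h0
  set t := Real.sqrt (1 - δ ^ 2 / a ^ 2)
  have hta : (t * a) ^ 2 = a ^ 2 - δ ^ 2 := by
    rw [mul_pow, ht]
    field_simp
  rw [le_div_iff₀ (by positivity)]
  nlinarith [sq_nonneg (‖x‖ - t * a)]
end

section
/- Let δ, ε > 0 satisfy: δ < j_{1,1} − j_{0,1}; ε < |J₀(j_{1,1})|; and ε ≤ (1/√2) · (δ/(1+δ)) · √(1 − δ²/j_{0,1}²) · inf_{|r − j_{0,1}| < δ} |J₀'(r)|. Let [a, b] be the connected component of the set {r > 0 : |J₀(r)| ≤ ε} that contains j_{0,1}. Let A be the closed annulus {x ∈ ℝ² : j_{0,1} − δ ≤ |x| ≤ j_{0,1} + δ}. Let q be a C¹ function on A with ‖q‖_A < ε, and set F(x) = J₀(|x|) + q(x) for x ∈ A. Then the zero set {x ∈ A : F(x) = 0} has a nonempty connected component contained in the open annulus {x : a < |x| < b}. -/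
open Metric RealInnerProductSpace intervalIntegral

/-- The Bessel function of the first kind of integer order `n`:
`J_n(s) = (1/π) ∫₀^π cos (n θ - s sin θ) dθ`. -/
noncomputable def besselJ (n : ℕ) (s : ℝ) : ℝ :=
  (1 / Real.pi) * ∫ θ in (0:ℝ)..Real.pi, Real.cos (n * θ - s * Real.sin θ)

/-- `besselJZero n k` is the `k`-th smallest positive zero of `J_n` (with the
convention `besselJZero n 0 = 0`). -/
noncomputable def besselJZero (n : ℕ) : ℕ → ℝ
  | 0 => 0
  | k + 1 => sInf {r : ℝ | besselJZero n k < r ∧ besselJ n r = 0}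

/-- Rotation of a point of the plane by a right angle. -/
noncomputable def rotate90 (x : EuclideanSpace ℝ (Fin 2)) : EuclideanSpace ℝ (Fin 2) :=
  (WithLp.equiv 2 (Fin 2 → ℝ)).symm ![-(x 1), x 0]

/-- The polar `C¹` norm `‖u‖_A = sup_{x ∈ A} max (|u x|, |∂u/∂r|, |(1/r) ∂u/∂θ|)`. -/
noncomputable def polarC1Norm (A : Set (EuclideanSpace ℝ (Fin 2)))
    (u : EuclideanSpace ℝ (Fin 2) → ℝ) : ℝ :=
  ⨆ x : A, max |u x| (max
    |⟪gradient u x, ‖(x : EuclideanSpace ℝ (Fin 2))‖⁻¹ • (x : EuclideanSpace ℝ (Fin 2))⟫|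
    |⟪gradient u x, ‖(x : EuclideanSpace ℝ (Fin 2))‖⁻¹ • rotate90 (x : EuclideanSpace ℝ (Fin 2))⟫|)


theorem besselJ_zero_continuous : Continuous (besselJ 0) := by
  unfold besselJ
  refine continuous_const.mul ?_
  apply intervalIntegral.continuous_parametric_intervalIntegral_of_continuous'
  fun_prop

theorem besselJ_zero_even (s : ℝ) : besselJ 0 (-s) = besselJ 0 s := by
  unfold besselJ
  congr 1
  apply intervalIntegral.integral_congr
  intro θ _
  simp

theorem besselJ_zero_zero : besselJ 0 0 = 1 := by
  unfold besselJ
  simp [Real.pi_ne_zero]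

theorem deriv_besselJ_zero_zero : deriv (besselJ 0) 0 = 0 := by
  have h : (fun s => besselJ 0 (-s)) = besselJ 0 := funext besselJ_zero_even
  have h2 := deriv_comp_neg (besselJ 0) 0
  rw [h] at h2
  simp at h2
  linarith

/-- The first zero is `0` (if there is no zero), or a positive zero below which `J₀ > 0`. -/
theorem besselJZero_spec : besselJZero 0 1 = 0 ∨
    (0 < besselJZero 0 1 ∧ besselJ 0 (besselJZero 0 1) = 0 ∧
      ∀ r, 0 < r → r < besselJZero 0 1 → 0 < besselJ 0 r) := by
  have hdef : besselJZero 0 1 = sInf {r : ℝ | 0 < r ∧ besselJ 0 r = 0} := by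
    simp [besselJZero]
  rw [hdef]
  set S := {r : ℝ | 0 < r ∧ besselJ 0 r = 0} with hS
  rcases S.eq_empty_or_nonempty with he | hne
  · left; rw [he]; simp
  right
  have hS' : S = {r : ℝ | 0 ≤ r ∧ besselJ 0 r = 0} := by
    ext r
    simp only [hS, Set.mem_ofPred_eq]
    constructor
    · rintro ⟨h, h'⟩; exact ⟨h.le, h'⟩
    · rintro ⟨h, h'⟩
      refine ⟨lt_of_le_of_ne h ?_, h'⟩
      rintro rfl
      rw [besselJ_zero_zero] at h'
      norm_num at h'
  have hcl : IsClosed S := by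
    rw [hS']
    exact (isClosed_le continuous_const continuous_id).inter
      (isClosed_eq besselJ_zero_continuous continuous_const)
  have hbdd : BddBelow S := ⟨0, fun r hr => hr.1.le⟩
  have hmem := hcl.csInf_mem hne hbdd
  refine ⟨hmem.1, hmem.2, fun r hr0 hr => ?_⟩
  by_contra hneg
  push Not at hneg
  have := intermediate_value_Icc' hr0.le (besselJ_zero_continuous.continuousOn)
  obtain ⟨c, hc, hc0⟩ := this ⟨hneg, by rw [besselJ_zero_zero]; norm_num⟩
  have hcS : c ∈ S := by rw [hS']; exact ⟨hc.1, hc0⟩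
  have := csInf_le hbdd hcS
  linarith [hc.2]

/-- If `δ < j₁₁ - j₀₁`, `ε < |J₀(j₁₁)|`,
`ε ≤ (1/√2)(δ/(1+δ))√(1-δ²/j₀₁²) inf_{|r-j₀₁|<δ} |J₀'(r)|`, `[a, b]` is the connected
component of `{r > 0 : |J₀(r)| ≤ ε}` containing `j₀₁`, `A` is the closed annulus
`j₀₁ - δ ≤ |x| ≤ j₀₁ + δ`, and `q` is `C¹` on `A` with `‖q‖_A < ε`, then the zero
set of `F = J₀(|·|) + q` inside `A` has a nonempty connected component contained in
the open annulus `a < |x| < b`. -/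
theorem nodal_line_stays_in_annulus
    (δ ε : ℝ) (hδ0 : 0 < δ) (hε0 : 0 < ε)
    (hδ : δ < besselJZero 1 1 - besselJZero 0 1)
    (hε1 : ε < |besselJ 0 (besselJZero 1 1)|)
    (hε2 : ε ≤ (1 / Real.sqrt 2) * (δ / (1 + δ)) *
      Real.sqrt (1 - δ ^ 2 / besselJZero 0 1 ^ 2) *
      (⨅ r : {r : ℝ // |r - besselJZero 0 1| < δ}, |deriv (besselJ 0) r|))
    (a b : ℝ)
    (hab : connectedComponentIn {r : ℝ | 0 < r ∧ |besselJ 0 r| ≤ ε} (besselJZero 0 1)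
      = Set.Icc a b)
    (A : Set (EuclideanSpace ℝ (Fin 2)))
    (hA : A = {x | besselJZero 0 1 - δ ≤ ‖x‖ ∧ ‖x‖ ≤ besselJZero 0 1 + δ})
    (q : EuclideanSpace ℝ (Fin 2) → ℝ)
    (hq1 : ∀ x ∈ A, DifferentiableAt ℝ q x)
    (hq2 : ContinuousOn (gradient q) A)
    (hqnorm : polarC1Norm A q < ε)
    (F : EuclideanSpace ℝ (Fin 2) → ℝ)
    (hF : ∀ x ∈ A, F x = besselJ 0 ‖x‖ + q x) :
    ∃ x ∈ {y ∈ A | F y = 0},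
      connectedComponentIn {y ∈ A | F y = 0} x ⊆ {y | a < ‖y‖ ∧ ‖y‖ < b} := by
  set j := besselJZero 0 1 with hj
  set m := (⨅ r : {r : ℝ // |r - j| < δ}, |deriv (besselJ 0) r|) with hm
  have hbb : BddBelow (Set.range fun r : {r : ℝ // |r - j| < δ} => |deriv (besselJ 0) r|) :=
    ⟨0, by rintro _ ⟨r, rfl⟩; exact abs_nonneg _⟩
  have hmle : ∀ r : ℝ, |r - j| < δ → m ≤ |deriv (besselJ 0) r| := fun r hr =>
    ciInf_le hbb ⟨r, hr⟩
  have hm0' : 0 ≤ m := Real.iInf_nonneg fun r => abs_nonneg _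
  have hprod := lt_of_lt_of_le hε0 hε2
  have hm0 : 0 < m := by
    rcases hm0'.lt_or_eq with h | h
    · exact h
    · rw [← h, mul_zero] at hprod; exact absurd hprod (lt_irrefl _)
  obtain ⟨hj0, hJj, hJpos⟩ : 0 < j ∧ besselJ 0 j = 0 ∧ ∀ r, 0 < r → r < j → 0 < besselJ 0 r := by
    rcases besselJZero_spec with h | h
    · exfalso
      have := hmle 0 (by rw [hj, h]; simpa using hδ0)
      rw [deriv_besselJ_zero_zero, abs_zero] at this
      linarith
    · exact h
  have hsq : 0 < Real.sqrt (1 - δ ^ 2 / j ^ 2) := by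
    rcases (Real.sqrt_nonneg (1 - δ ^ 2 / j ^ 2)).lt_or_eq with h | h
    · exact h
    · rw [← h, mul_zero, zero_mul] at hprod; exact absurd hprod (lt_irrefl _)
  have hδj : δ < j := by
    have h1 := Real.sqrt_pos.1 hsq
    have h2 : δ ^ 2 / j ^ 2 < 1 := by linarith
    rw [div_lt_one (by positivity)] at h2
    exact lt_of_pow_lt_pow_left₀ 2 hj0.le h2
  have hεm : ε < δ * m := by
    have h1 : Real.sqrt (1 - δ ^ 2 / j ^ 2) ≤ 1 := by
      rw [Real.sqrt_le_one]
      have : 0 ≤ δ ^ 2 / j ^ 2 := by positivity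
      linarith
    have h2 : 1 / Real.sqrt 2 ≤ 1 := by
      rw [div_le_one (by positivity)]
      exact Real.one_le_sqrt.2 (by norm_num)
    have h3 : δ / (1 + δ) < δ := by
      rw [div_lt_iff₀ (by linarith)]; nlinarith
    have h30 : 0 < δ / (1 + δ) := by positivity
    calc ε ≤ _ := hε2
      _ ≤ 1 * (δ / (1 + δ)) * 1 * m := by gcongr
      _ < δ * m := by nlinarith
  have hdne : ∀ r, |r - j| < δ → deriv (besselJ 0) r ≠ 0 := by
    intro r hr h
    have := hmle r hr
    rw [h, abs_zero] at this
    linarith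
  have hdiff : ∀ r, |r - j| < δ → DifferentiableAt ℝ (besselJ 0) r := fun r hr =>
    differentiableAt_of_deriv_ne_zero (hdne r hr)
  have hcont := besselJ_zero_continuous
  have hIoo : ∀ r ∈ Set.Ioo (j - δ) (j + δ), |r - j| < δ := by
    intro r hr
    rw [abs_lt]
    constructor <;> linarith [hr.1, hr.2]
  have hpos : 0 < besselJ 0 (j - δ) := hJpos _ (by linarith) (by linarith)
  have hneg : ∀ r, |r - j| < δ → deriv (besselJ 0) r < 0 := by
    have := hasDerivWithinAt_forall_lt_or_forall_gt_of_forall_ne (m := 0)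
      (convex_Ioo (j - δ) (j + δ))
      (fun r hr => (hdiff r (hIoo r hr)).hasDerivAt.hasDerivWithinAt)
      (fun r hr => hdne r (hIoo r hr))
    rcases this with h | h
    · intro r hr
      rw [abs_lt] at hr
      exact h r ⟨by linarith, by linarith⟩
    · exfalso
      have hmono : StrictMonoOn (besselJ 0) (Set.Icc (j - δ) (j + δ)) := by
        apply strictMonoOn_of_deriv_pos (convex_Icc _ _) hcont.continuousOn
        rw [interior_Icc]; exact h
      have := hmono (a := j - δ) (b := j) ⟨by linarith, by linarith⟩ ⟨by linarith, by linarith⟩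
        (by linarith)
      linarith
  have hanti : StrictAntiOn (besselJ 0) (Set.Icc (j - δ) (j + δ)) := by
    apply strictAntiOn_of_deriv_neg (convex_Icc _ _) hcont.continuousOn
    rw [interior_Icc]; exact fun r hr => hneg r (hIoo r hr)
  have hderm : ∀ r, |r - j| < δ → deriv (besselJ 0) r ≤ -m := by
    intro r hr
    have h1 := hmle r hr
    rw [abs_of_neg (hneg r hr)] at h1
    linarith
  have hL : ε < besselJ 0 (j - δ) := by
    obtain ⟨c, hc, hc'⟩ := exists_deriv_eq_slope (besselJ 0) (a := j - δ) (b := j) (by linarith)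
      hcont.continuousOn (fun r hr => (hdiff r (hIoo r ⟨hr.1, by linarith [hr.2]⟩)).differentiableWithinAt)
    have h1 := hderm c (hIoo c ⟨hc.1, by linarith [hc.2]⟩)
    rw [hc', hJj, div_le_iff₀ (by linarith)] at h1
    linarith
  have hR : besselJ 0 (j + δ) < -ε := by
    obtain ⟨c, hc, hc'⟩ := exists_deriv_eq_slope (besselJ 0) (a := j) (b := j + δ) (by linarith)
      hcont.continuousOn (fun r hr => (hdiff r (hIoo r ⟨by linarith [hr.1], hr.2⟩)).differentiableWithinAt)
    have h1 := hderm c (hIoo c ⟨by linarith [hc.1], hc.2⟩)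
    rw [hc', hJj, div_le_iff₀ (by linarith)] at h1
    linarith
  obtain ⟨a', ha', hJa⟩ := intermediate_value_Icc' (by linarith : j - δ ≤ j) hcont.continuousOn
    (show ε ∈ Set.Icc (besselJ 0 j) (besselJ 0 (j - δ)) from ⟨by linarith, hL.le⟩)
  obtain ⟨b', hb', hJb⟩ := intermediate_value_Icc' (by linarith : j ≤ j + δ) hcont.continuousOn
    (show -ε ∈ Set.Icc (besselJ 0 (j + δ)) (besselJ 0 j) from ⟨hR.le, by linarith⟩)
  have ha'm : a' ∈ Set.Icc (j - δ) (j + δ) := ⟨ha'.1, by linarith [ha'.2]⟩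
  have hb'm : b' ∈ Set.Icc (j - δ) (j + δ) := ⟨by linarith [hb'.1], hb'.2⟩
  have hab' : a' ≤ b' := ha'.2.trans hb'.1
  have hsub : Set.Icc a' b' ⊆ Set.Icc a b := by
    rw [← hab]
    apply isPreconnected_Icc.subset_connectedComponentIn ⟨ha'.2, hb'.1⟩
    intro r hr
    have hrm : r ∈ Set.Icc (j - δ) (j + δ) := ⟨ha'm.1.trans hr.1, hr.2.trans hb'm.2⟩
    refine ⟨by linarith [hrm.1], ?_⟩
    rw [abs_le]
    have h1 := hanti.antitoneOn ha'm hrm hr.1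
    have h2 := hanti.antitoneOn hrm hb'm hr.2
    constructor <;> linarith
  have haa : a ≤ a' := (hsub (Set.left_mem_Icc.2 hab')).1
  have hbb' : b' ≤ b := (hsub (Set.right_mem_Icc.2 hab')).2
  have hqc : ContinuousOn q A := fun x hx => (hq1 x hx).continuousAt.continuousWithinAt
  have hA0 : ∀ x ∈ A, ‖x‖ ≠ 0 := by
    intro x hx
    rw [hA] at hx
    have := hx.1
    intro h
    linarith
  have hAc : IsCompact A := by
    apply Metric.isCompact_of_isClosed_isBounded
    · rw [hA]
      exact (isClosed_le continuous_const continuous_norm).inter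
        (isClosed_le continuous_norm continuous_const)
    · refine (Metric.isBounded_closedBall (x := 0) (r := j + δ)).subset ?_
      rw [hA]
      intro x hx
      simpa using hx.2
  have hrot : Continuous rotate90 := by
    unfold rotate90
    apply (PiLp.continuous_toLp 2 (fun _ : Fin 2 => ℝ)).comp
    refine continuous_pi fun i => ?_
    fin_cases i
    · simp; fun_prop
    · simp; fun_prop
  have hinv : ContinuousOn (fun x : EuclideanSpace ℝ (Fin 2) => ‖x‖⁻¹) A :=
    continuous_norm.continuousOn.inv₀ hA0
  have hq : ∀ x ∈ A, |q x| < ε := by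
    intro x hx
    refine lt_of_le_of_lt ?_ hqnorm
    have hcc : ContinuousOn (fun x : EuclideanSpace ℝ (Fin 2) => max |q x| (max
      |⟪gradient q x, ‖x‖⁻¹ • x⟫| |⟪gradient q x, ‖x‖⁻¹ • rotate90 x⟫|)) A := by
      refine hqc.abs.sup ((ContinuousOn.abs ?_).sup (ContinuousOn.abs ?_))
      · exact hq2.inner (𝕜 := ℝ) (hinv.smul continuousOn_id)
      · exact hq2.inner (𝕜 := ℝ) (hinv.smul hrot.continuousOn)
    have hbd := hAc.bddAbove_image hcc
    rw [Set.image_eq_range] at hbd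
    exact (le_max_left _ _).trans (le_ciSup hbd ⟨x, hx⟩)
  let e : EuclideanSpace ℝ (Fin 2) := EuclideanSpace.single 0 1
  have he : ‖e‖ = 1 := by simp [e]
  have hn : ∀ r ∈ Set.Icc a' b', ‖r • e‖ = r := by
    intro r hr
    rw [norm_smul, he, mul_one, Real.norm_of_nonneg]
    linarith [hr.1, ha'.1]
  have hrA : ∀ r ∈ Set.Icc a' b', r • e ∈ A := by
    intro r hr
    rw [hA]
    show _ ≤ ‖r • e‖ ∧ ‖r • e‖ ≤ _
    rw [hn r hr]
    exact ⟨ha'm.1.trans hr.1, hr.2.trans hb'm.2⟩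
  have hgc : ContinuousOn (fun r : ℝ => besselJ 0 r + q (r • e)) (Set.Icc a' b') := by
    refine hcont.continuousOn.add (hqc.comp (by fun_prop) hrA)
  have hqa := abs_lt.1 (hq _ (hrA a' (Set.left_mem_Icc.2 hab')))
  have hqb := abs_lt.1 (hq _ (hrA b' (Set.right_mem_Icc.2 hab')))
  obtain ⟨r, hr, hr0⟩ := intermediate_value_Icc' hab' hgc
    (show (0 : ℝ) ∈ Set.Icc _ _ from ⟨by simp only [hJb]; linarith, by simp only [hJa]; linarith⟩)
  refine ⟨r • e, ⟨hrA r hr, ?_⟩, (connectedComponentIn_subset _ _).trans ?_⟩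
  · rw [hF _ (hrA r hr), hn r hr]; exact hr0
  · rintro y ⟨hyA, hy0⟩
    rw [hF y hyA] at hy0
    have hqy := abs_lt.1 (hq y hyA)
    have hym : ‖y‖ ∈ Set.Icc (j - δ) (j + δ) := by rw [hA] at hyA; exact hyA
    constructor
    · refine lt_of_le_of_lt haa ?_
      by_contra h
      push Not at h
      have := hanti.antitoneOn hym ha'm h
      linarith
    · refine lt_of_lt_of_le ?_ hbb'
      by_contra h
      push Not at h
      have := hanti.antitoneOn hb'm hym h
      linarith
end

section
/- Let F : ℝ² → ℝ be a smooth function satisfying ΔF + F = 0, and let z ∈ ℝ². Then for every x ∈ ℝ², (1/(2π)) ∫₀^{2π} F( z + R_θ(x − z) ) dθ = F(z) · J₀(|x − z|), where R_θ denotes the rotation of ℝ² by angle θ about the origin. That is, the radial symmetrization of F around z equals F(z) times the radial Bessel eigenfunction centered at z. -/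
open Metric intervalIntegral

/-- Rotation of the plane by angle `θ` about the origin. -/
noncomputable def planeRot (θ : ℝ) (x : EuclideanSpace ℝ (Fin 2)) :
    EuclideanSpace ℝ (Fin 2) :=
  (WithLp.equiv 2 (Fin 2 → ℝ)).symm
    ![Real.cos θ * x 0 - Real.sin θ * x 1, Real.sin θ * x 0 + Real.cos θ * x 1]

/-- The Euclidean Laplacian of a function on the plane. -/
noncomputable def laplacian (f : EuclideanSpace ℝ (Fin 2) → ℝ)
    (x : EuclideanSpace ℝ (Fin 2)) : ℝ :=
  ∑ i : Fin 2, fderiv ℝ (fun y => fderiv ℝ f y (EuclideanSpace.single i 1)) x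
    (EuclideanSpace.single i 1)

/-- Differentiation under the integral sign, jointly continuous version. -/
lemma hasDerivAt_integral_aux (f f' : ℝ → ℝ → ℝ) (a b : ℝ)
    (hf : Continuous (fun x : ℝ × ℝ => f x.1 x.2))
    (hf' : Continuous (fun x : ℝ × ℝ => f' x.1 x.2))
    (hd : ∀ t θ, HasDerivAt (fun t => f t θ) (f' t θ) t) (t : ℝ) :
    HasDerivAt (fun t => ∫ θ in a..b, f t θ) (∫ θ in a..b, f' t θ) t := by
  have hK : IsCompact (Metric.closedBall t 1 ×ˢ Set.uIcc a b) :=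
    (isCompact_closedBall t 1).prod isCompact_uIcc
  obtain ⟨C, hC⟩ := hK.exists_bound_of_continuousOn hf'.continuousOn
  have h1 : ∀ s, Continuous (f s) := fun s => hf.comp (by fun_prop : Continuous fun θ : ℝ => (s, θ))
  have h2 : ∀ s, Continuous (f' s) :=
    fun s => hf'.comp (by fun_prop : Continuous fun θ : ℝ => (s, θ))
  refine (intervalIntegral.hasDerivAt_integral_of_dominated_loc_of_deriv_le (bound := fun _ => C)
    (Metric.closedBall_mem_nhds t one_pos) (Filter.Eventually.of_forall fun s =>
      (h1 s).aestronglyMeasurable) ((h1 t).intervalIntegrable _ _) (h2 t).aestronglyMeasurable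
    ?_ (by simp) ?_).2
  · refine Filter.Eventually.of_forall fun θ hθ s hs => ?_
    exact hC (s, θ) ⟨hs, Set.uIoc_subset_uIcc hθ⟩
  · exact Filter.Eventually.of_forall fun θ _ s _ => hd s θ

/-- Uniqueness for the Bessel-type equation by an energy argument. -/
lemma ode_aux (v v' v'' : ℝ → ℝ) (c : ℝ) (hc : 0 ≤ c)
    (h1 : ∀ t, HasDerivAt v (v' t) t) (h2 : ∀ t, HasDerivAt v' (v'' t) t)
    (ho : ∀ t, t * v'' t + v' t + c * t * v t = 0) (h0 : v 0 = 0) : v 1 = 0 := by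
  have hv'0 : v' 0 = 0 := by simpa using ho 0
  have hE : ∀ t, HasDerivAt (fun t => v' t ^ 2 + c * v t ^ 2)
      (2 * v' t * v'' t + c * (2 * v t * v' t)) t := by
    intro t
    have := ((h2 t).pow 2).add (((h1 t).pow 2).const_mul c)
    exact HasDerivAt.congr_deriv (f := fun t => v' t ^ 2 + c * v t ^ 2) this (by simp)
  have hanti : AntitoneOn (fun t => v' t ^ 2 + c * v t ^ 2) (Set.Ici 0) := by
    apply antitoneOn_of_deriv_nonpos (convex_Ici 0)
    · exact fun t _ => (hE t).continuousAt.continuousWithinAt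
    · exact fun t _ => (hE t).differentiableAt.differentiableWithinAt
    · intro t ht
      rw [interior_Ici, Set.mem_Ioi] at ht
      rw [(hE t).deriv]
      have h := ho t
      have : t * (2 * v' t * v'' t + c * (2 * v t * v' t)) = -2 * v' t ^ 2 := by
        linear_combination 2 * v' t * h
      by_contra! hcon
      nlinarith [mul_pos ht hcon, sq_nonneg (v' t)]
  have hz : ∀ t, 0 ≤ t → v' t = 0 := by
    intro t ht
    have := hanti (Set.self_mem_Ici) (Set.mem_Ici.2 ht) ht
    simp only [hv'0, h0] at this
    have h3 : v' t ^ 2 = 0 := by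
      have := mul_nonneg hc (sq_nonneg (v t))
      nlinarith [sq_nonneg (v' t)]
    simpa using h3
  obtain ⟨s, hs, hs'⟩ := exists_hasDerivAt_eq_slope v v' (zero_lt_one)
    (fun t _ => (h1 t).continuousAt.continuousWithinAt) (fun t _ => h1 t)
  rw [hz s hs.1.le, h0] at hs'
  simpa using hs'.symm

/-- Vanishing of circular means. -/
lemma core_aux {E : Type*} [NormedAddCommGroup E] [NormedSpace ℝ E]
    (H : E → ℝ) (hH : ContDiff ℝ (⊤ : ℕ∞) H) (z p q : E) (c : ℝ) (hc : 0 ≤ c)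
    (h : ∀ y, fderiv ℝ (fderiv ℝ H) y p p + fderiv ℝ (fderiv ℝ H) y q q = - c * H y)
    (hz : H z = 0) :
    ∫ θ in (0:ℝ)..(2 * Real.pi), H (z + (Real.cos θ • p + Real.sin θ • q)) = 0 := by
  have hD1 : ContDiff ℝ (⊤ : ℕ∞) (fderiv ℝ H) := hH.fderiv_right (by simp)
  have hD2 : ContDiff ℝ (⊤ : ℕ∞) (fderiv ℝ (fderiv ℝ H)) := hD1.fderiv_right (by simp)
  have cH := hH.continuous
  have cD1 := hD1.continuous
  have cD2 := hD2.continuous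
  have dH : ∀ y, HasFDerivAt H (fderiv ℝ H y) y :=
    fun y => (hH.differentiable (by simp) y).hasFDerivAt
  have dD : ∀ y, HasFDerivAt (fderiv ℝ H) (fderiv ℝ (fderiv ℝ H) y) y :=
    fun y => (hD1.differentiable (by simp) y).hasFDerivAt
  set e : ℝ → E := fun θ => Real.cos θ • p + Real.sin θ • q with he
  set e' : ℝ → E := fun θ => -Real.sin θ • p + Real.cos θ • q with he'
  have ce : Continuous e := by fun_prop
  have ce' : Continuous e' := by fun_prop
  have de : ∀ θ, HasDerivAt e (e' θ) θ := fun θ =>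
    ((Real.hasDerivAt_cos θ).smul_const p).add ((Real.hasDerivAt_sin θ).smul_const q)
  have de' : ∀ θ, HasDerivAt e' (-e θ) θ := fun θ => by
    have := ((Real.hasDerivAt_sin θ).neg.smul_const p).add
      ((Real.hasDerivAt_cos θ).smul_const q)
    exact HasDerivAt.congr_deriv (f := e') this (by simp only [he]; module)
  have dt : ∀ t θ, HasDerivAt (fun t : ℝ => z + t • e θ) (e θ) t := fun t θ => by
    simpa using ((hasDerivAt_id t).smul_const (e θ)).const_add z
  have dθ : ∀ t θ : ℝ, HasDerivAt (fun θ : ℝ => z + t • e θ) (t • e' θ) θ := fun t θ => by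
    have := (de θ).const_smul t
    exact HasDerivAt.const_add (f := fun θ => t • e θ) z this
  have h1 := hasDerivAt_integral_aux (fun t θ => H (z + t • e θ))
    (fun t θ => fderiv ℝ H (z + t • e θ) (e θ)) 0 (2 * Real.pi) (by fun_prop) (by fun_prop)
    (fun t θ => (dH _).comp_hasDerivAt t (dt t θ))
  have h2 := hasDerivAt_integral_aux (fun t θ => fderiv ℝ H (z + t • e θ) (e θ))
    (fun t θ => fderiv ℝ (fderiv ℝ H) (z + t • e θ) (e θ) (e θ)) 0 (2 * Real.pi)
    (by fun_prop) (by fun_prop)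
    (fun t θ => by
      simpa using ((dD _).comp_hasDerivAt t (dt t θ)).clm_apply (hasDerivAt_const t (e θ)))
  have key := ode_aux _ _ _ c hc h1 h2 ?_ ?_
  · simpa using key
  · intro t
    have hg : ∀ θ, HasDerivAt (fun θ => fderiv ℝ H (z + t • e θ) (e' θ))
        (t * fderiv ℝ (fderiv ℝ H) (z + t • e θ) (e' θ) (e' θ)
          - fderiv ℝ H (z + t • e θ) (e θ)) θ := fun θ => by
      have := ((dD _).comp_hasDerivAt θ (dθ t θ)).clm_apply (de' θ)
      exact HasDerivAt.congr_deriv (f := fun θ => fderiv ℝ H (z + t • e θ) (e' θ)) this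
        (by simp [sub_eq_add_neg])
    have hint := intervalIntegral.integral_eq_sub_of_hasDerivAt (a := 0) (b := 2 * Real.pi)
      (fun θ _ => hg θ) (Continuous.intervalIntegrable (by fun_prop) _ _)
    have hper : fderiv ℝ H (z + t • e (2 * Real.pi)) (e' (2 * Real.pi))
        - fderiv ℝ H (z + t • e 0) (e' 0) = 0 := by
      simp [he, he']
    rw [hper] at hint
    have hpt : ∀ θ, t * fderiv ℝ (fderiv ℝ H) (z + t • e θ) (e θ) (e θ)
        + fderiv ℝ H (z + t • e θ) (e θ) + c * t * H (z + t • e θ)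
        = -(t * fderiv ℝ (fderiv ℝ H) (z + t • e θ) (e' θ) (e' θ)
          - fderiv ℝ H (z + t • e θ) (e θ)) := by
      intro θ
      have hy := h (z + t • e θ)
      have hb : fderiv ℝ (fderiv ℝ H) (z + t • e θ) (e θ) (e θ)
          + fderiv ℝ (fderiv ℝ H) (z + t • e θ) (e' θ) (e' θ)
          = - c * H (z + t • e θ) := by
        rw [← hy]
        generalize fderiv ℝ (fderiv ℝ H) (z + t • e θ) = B
        simp only [he, he', map_add, map_smul, add_apply, smul_apply, smul_eq_mul]
        linear_combination (B p p + B q q) * Real.sin_sq_add_cos_sq θ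
      linear_combination t * hb
    rw [← intervalIntegral.integral_const_mul, ← intervalIntegral.integral_const_mul,
      ← intervalIntegral.integral_add, ← intervalIntegral.integral_add,
      intervalIntegral.integral_congr (fun θ _ => hpt θ), intervalIntegral.integral_neg, hint,
      neg_zero]
    all_goals exact Continuous.intervalIntegrable (by fun_prop) _ _
  · simp [hz]

lemma bessel_aux (a b : ℝ) :
    ∫ θ in (0:ℝ)..(2 * Real.pi), Real.cos (Real.cos θ * a - Real.sin θ * b)
      = 2 * Real.pi * besselJ 0 (Real.sqrt (a ^ 2 + b ^ 2)) := by
  set r := Real.sqrt (a ^ 2 + b ^ 2) with hr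
  obtain ⟨φ, hφ⟩ : ∃ φ, a = r * Real.sin φ ∧ b = - (r * Real.cos φ) := by
    have hn : ‖(⟨-b, a⟩ : ℂ)‖ = r := by
      rw [hr, Complex.norm_def, Complex.normSq_mk]; ring_nf
    refine ⟨Complex.arg ⟨-b, a⟩, ?_, ?_⟩
    · have := Complex.norm_mul_sin_arg ⟨-b, a⟩
      rw [hn] at this; exact this.symm
    · have := Complex.norm_mul_cos_arg ⟨-b, a⟩
      rw [hn] at this; rw [this]; simp
  obtain ⟨ha, hb⟩ := hφ
  have e1 : ∀ θ, Real.cos (Real.cos θ * a - Real.sin θ * b)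
      = (fun s => Real.cos (r * Real.sin s)) (θ + φ) := by
    intro θ
    simp only [Real.sin_add]
    congr 1
    linear_combination Real.cos θ * ha - Real.sin θ * hb
  have hper : Function.Periodic (fun s => Real.cos (r * Real.sin s)) Real.pi := by
    intro s
    simp [Real.sin_add_pi]
  have hper2 : Function.Periodic (fun s => Real.cos (r * Real.sin s)) (2 * Real.pi) := by
    intro s
    simp
  have hc : Continuous (fun s => Real.cos (r * Real.sin s)) := by fun_prop
  rw [intervalIntegral.integral_congr (fun θ _ => e1 θ),
    intervalIntegral.integral_comp_add_right (fun s => Real.cos (r * Real.sin s)) φ, zero_add,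
    add_comm (2 * Real.pi) φ, hper2.intervalIntegral_add_eq φ 0, zero_add,
    ← intervalIntegral.integral_add_adjacent_intervals (b := Real.pi)
      (hc.intervalIntegrable _ _) (hc.intervalIntegrable _ _)]
  have h3 := hper.intervalIntegral_add_eq Real.pi 0
  rw [zero_add, ← two_mul] at h3
  rw [h3, besselJ]
  simp only [Nat.cast_zero, zero_mul, zero_sub, Real.cos_neg]
  field_simp [Real.pi_ne_zero]
  ring

/-- If `ΔF + F = 0` then the radial symmetrization of `F` around `z` equals
`F(z) J₀(|x - z|)`. -/
theorem radialSymmetrization_eq_besselJ0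
    (F : EuclideanSpace ℝ (Fin 2) → ℝ) (hF : ContDiff ℝ (⊤ : ℕ∞) F)
    (hEq : ∀ x, laplacian F x + F x = 0)
    (z x : EuclideanSpace ℝ (Fin 2)) :
    (1 / (2 * Real.pi)) * ∫ θ in (0:ℝ)..(2 * Real.pi), F (z + planeRot θ (x - z))
      = F z * besselJ 0 ‖x - z‖ := by
  set p := x - z with hp
  set q : EuclideanSpace ℝ (Fin 2) := !₂[-p 1, p 0] with hq
  have hrot : ∀ θ, planeRot θ p = Real.cos θ • p + Real.sin θ • q := by
    intro θ
    ext i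
    fin_cases i <;> simp [planeRot, hq] <;> ring
  set e0 : EuclideanSpace ℝ (Fin 2) := EuclideanSpace.single 0 1 with he0
  set e1 : EuclideanSpace ℝ (Fin 2) := EuclideanSpace.single 1 1 with he1
  have hpe : p = p 0 • e0 + p 1 • e1 := by
    ext i
    fin_cases i <;> simp [he0, he1]
  have hqe : q = (-p 1) • e0 + p 0 • e1 := by
    ext i
    fin_cases i <;> simp [he0, he1, hq]
  set P : EuclideanSpace ℝ (Fin 2) →L[ℝ] ℝ := EuclideanSpace.proj 0 with hP
  have hPa : ∀ y, P y = y 0 := fun y => rfl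
  set G : EuclideanSpace ℝ (Fin 2) → ℝ := fun y => Real.cos (P y - P z) with hG
  have hGc : ContDiff ℝ (⊤ : ℕ∞) G := by fun_prop
  have hDG : fderiv ℝ G = fun y => (-Real.sin (P y - P z)) • P := by
    funext y
    exact ((P.hasFDerivAt.sub_const (P z)).cos).fderiv
  have hD2G : ∀ y, fderiv ℝ (fderiv ℝ G) y
      = (((-(Real.cos (P y - P z) • P)) : EuclideanSpace ℝ (Fin 2) →L[ℝ] ℝ)).smulRight P := by
    intro y
    rw [hDG]
    exact (((P.hasFDerivAt.sub_const (P z)).sin).neg.smul_const P).fderiv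
  have hFD : ContDiff ℝ (⊤ : ℕ∞) (fderiv ℝ F) := hF.fderiv_right (by simp)
  have hGD : ContDiff ℝ (⊤ : ℕ∞) (fderiv ℝ G) := hGc.fderiv_right (by simp)
  have dF := hF.differentiable (by simp)
  have dG := hGc.differentiable (by simp)
  have dFD := hFD.differentiable (by simp)
  have dGD := hGD.differentiable (by simp)
  have hlap : ∀ y, fderiv ℝ (fderiv ℝ F) y e0 e0 + fderiv ℝ (fderiv ℝ F) y e1 e1 = - F y := by
    intro y
    have := hEq y
    have hh : ∀ e : EuclideanSpace ℝ (Fin 2), fderiv ℝ (fun y => fderiv ℝ F y e) y e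
        = fderiv ℝ (fderiv ℝ F) y e e := by
      intro e
      rw [((dFD y).hasFDerivAt.clm_apply (hasFDerivAt_const e y)).fderiv]
      simp
    simp only [laplacian, Fin.sum_univ_two, hh] at this
    linarith
  set H : EuclideanSpace ℝ (Fin 2) → ℝ := fun y => F y - F z * G y with hH
  have hDH : fderiv ℝ H = fun y => fderiv ℝ F y - F z • fderiv ℝ G y := by
    funext y
    exact ((dF y).hasFDerivAt.sub ((dG y).hasFDerivAt.const_mul (F z))).fderiv
  have hD2H : ∀ y, fderiv ℝ (fderiv ℝ H) y
      = fderiv ℝ (fderiv ℝ F) y - F z • fderiv ℝ (fderiv ℝ G) y := by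
    intro y
    rw [hDH]
    exact ((dFD y).hasFDerivAt.sub ((dGD y).hasFDerivAt.const_smul (F z))).fderiv
  have hmain := core_aux H (by fun_prop) z p q (p 0 ^ 2 + p 1 ^ 2) (by positivity) (by
    intro y
    have hL : fderiv ℝ (fderiv ℝ H) y e0 e0 + fderiv ℝ (fderiv ℝ H) y e1 e1 = - H y := by
      rw [hD2H, hD2G]
      have h0 : P e0 = 1 := by simp [hPa, he0]
      have h1 : P e1 = 0 := by simp [hPa, he1]
      simp [h0, h1, hH, hG]
      linarith [hlap y]
    generalize fderiv ℝ (fderiv ℝ H) y = B at hL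
    rw [hqe]
    generalize hp0 : p 0 = a at *
    generalize hp1 : p 1 = b at *
    rw [hpe]
    simp only [map_add, map_smul, add_apply, smul_apply, smul_eq_mul]
    linear_combination (a ^ 2 + b ^ 2) * hL) (by simp [hH, hG])
  have hnorm : ‖p‖ = Real.sqrt (p 0 ^ 2 + p 1 ^ 2) := by
    simp [EuclideanSpace.norm_eq, Fin.sum_univ_two]
  have hGr : ∀ θ, G (z + (Real.cos θ • p + Real.sin θ • q))
      = Real.cos (Real.cos θ * p 0 - Real.sin θ * p 1) := by
    intro θ
    simp only [hG, map_add, map_smul, hPa, hq]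
    congr 1
    simp
    ring
  have cF := hF.continuous
  simp only [hH, hGr] at hmain
  rw [intervalIntegral.integral_sub (Continuous.intervalIntegrable (by fun_prop) _ _)
    (Continuous.intervalIntegrable (by fun_prop) _ _), intervalIntegral.integral_const_mul,
    bessel_aux, ← hnorm, sub_eq_zero] at hmain
  simp only [hrot]
  rw [hmain]
  field_simp
end
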